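/- Let P be a finite, reduced, crystallographic root pairing over ℝ, let S be a finite set of roots, and let β be a root such that for every γ ∈ S, β + γ is not a root and β ≠ −γ. If moreover there exists γ ∈ S with ⟨β, γ∨⟩ ≠ 0, then ∑_{γ ∈ S} ⟨β, γ∨⟩ > 0. -/

import Mathlib

open RootPairing

theorem sum_pairing_pos_of_stronglyOrthogonal_set {ι M N : Type*} [Fintype ι]
    [AddCommGroup M] [Module ℝ M] [AddCommGroup N] [Module ℝ N]
    (P : RootPairing ι ℝ M N) (hcr : P.IsCrystallographic) (hred : P.IsReduced)
    (S : Finset ι) (b : ι)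
    (hsum : ∀ γ ∈ S, ∀ k, P.root k ≠ P.root b + P.root γ)
    (hneg : ∀ γ ∈ S, P.root b ≠ -P.root γ)
    (hex : ∃ γ ∈ S, P.pairing b γ ≠ 0) :
    0 < ∑ γ ∈ S, P.pairing b γ := by
  have hnn : ∀ γ ∈ S, 0 ≤ P.pairing b γ := by
    intro γ hγ
    by_contra h
    push Not at h
    have h2 : P.pairingIn ℤ b γ < 0 := by
      rw [← P.algebraMap_pairingIn ℤ] at h
      simpa using h
    obtain ⟨k, hk⟩ := P.root_add_root_mem_of_pairingIn_neg h2 (hneg γ hγ)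
    exact hsum γ hγ k hk
  obtain ⟨γ, hγ, h0⟩ := hex
  exact Finset.sum_pos' hnn ⟨γ, hγ, lt_of_le_of_ne (hnn γ hγ) h0.symm⟩
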